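/- arXiv:1307.8442 — 2 statements merged into one kernel-verified Lean document; each statement's English description precedes it below -/
import Mathlib

section
/- Let 𝒢 = (φ_j : G → G_j : 1 ≤ j ≤ m) be a finite Abelian group HBL datum (i.e., G and all G_j are finite) and let s ∈ [0,1]^m. Let G' be a subgroup with {0} < G' < G (nonzero and proper), with associated sub-datum 𝒢' = (φ_j|_{G'} : G' → φ_j(G')). If A(G',s) = 𝔸(𝒢',s), then 𝔹(𝒢,s) = 𝔸(𝒢,s). -/
open scoped ENNReal

/-- The `L^{1/s}` norm with respect to counting measure; for `s = 0` this is the sup norm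
`‖f‖_∞`, and for `s ≠ 0` it is `(∑_y f(y)^{1/s})^s`. -/
noncomputable def HBLnorm {α : Type*} (s : ℝ) (f : α → ℝ≥0∞) : ℝ≥0∞ :=
  if s = 0 then ⨆ y, f y else (∑' y, f y ^ (1 / s)) ^ s

/-- The optimal constant `𝔹(𝒢,s)`: the smallest `C ∈ [0,∞]` such that
`∑_{x ∈ G} ∏_j f_j(φ_j x) ≤ C ∏_j ‖f_j‖_{1/s_j}` for all nonnegative `f_j`. -/
noncomputable def HBLB {G : Type*} [AddCommGroup G] {m : ℕ} {Gj : Fin m → Type*}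
    [∀ j, AddCommGroup (Gj j)] (φ : ∀ j, G →+ Gj j) (s : Fin m → ℝ) : ℝ≥0∞ :=
  sInf {C : ℝ≥0∞ | ∀ f : ∀ j, Gj j → ℝ≥0∞,
    ∑' x : G, ∏ j, f j (φ j x) ≤ C * ∏ j, HBLnorm (s j) (f j)}

/-- The quantity `A(H,s) = |H| · ∏_j |φ_j(H)|^{-s_j}` associated to a subgroup `H ≤ G`. -/
noncomputable def HBLAloc {G : Type*} [AddCommGroup G] {m : ℕ} {Gj : Fin m → Type*}
    [∀ j, AddCommGroup (Gj j)] (φ : ∀ j, G →+ Gj j) (s : Fin m → ℝ) (H : AddSubgroup G) :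
    ℝ≥0∞ :=
  (Nat.card H : ℝ≥0∞) * ∏ j, (Nat.card (H.map (φ j)) : ℝ≥0∞) ^ (-(s j))

/-- `𝔸(𝒢,s) = sup { A(H,s) : H a finite subgroup of G }`. -/
noncomputable def HBLA {G : Type*} [AddCommGroup G] {m : ℕ} {Gj : Fin m → Type*}
    [∀ j, AddCommGroup (Gj j)] (φ : ∀ j, G →+ Gj j) (s : Fin m → ℝ) : ℝ≥0∞ :=
  ⨆ (H : AddSubgroup G) (_ : (H : Set G).Finite), HBLAloc φ s H

/-- `C` is an admissible constant: the inequality rewritten for `g j = f j ^ (1 / s j)`. -/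
def HBLBound {G : Type*} [AddCommGroup G] {m : ℕ} {Gj : Fin m → Type*}
    [∀ j, AddCommGroup (Gj j)] (φ : ∀ j, G →+ Gj j) (s : Fin m → ℝ) (C : ℝ≥0∞) : Prop :=
  ∀ g : ∀ j, Gj j → ℝ≥0∞,
    ∑' x, ∏ j, g j (φ j x) ^ s j ≤ C * ∏ j, (∑' y, g j y) ^ s j

/-- The logarithm of `A(H,s)`. -/
noncomputable def HBLlog {G : Type*} [AddCommGroup G] {m : ℕ} {Gj : Fin m → Type*}
    [∀ j, AddCommGroup (Gj j)] (φ : ∀ j, G →+ Gj j) (s : Fin m → ℝ) (H : AddSubgroup G) : ℝ :=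
  Real.log (Nat.card H) - ∑ j, s j * Real.log (Nat.card (H.map (φ j)))

section Counting

variable {A B : Type*} [AddCommGroup A] [AddCommGroup B]

theorem AddSubgroup.card_map_mul_card_inf_ker (f : A →+ B) (H : AddSubgroup A) :
    Nat.card (H.map f) * Nat.card (H ⊓ f.ker : AddSubgroup A) = Nat.card H := by
  have h := (f.comp H.subtype).ker.card_eq_card_quotient_mul_card_addSubgroup
  rw [h, Nat.card_congr (QuotientAddGroup.quotientKerEquivRange (f.comp H.subtype)).toEquiv]
  congr 1
  · rw [AddMonoidHom.range_comp, AddSubgroup.range_subtype]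
  · rw [← AddSubgroup.card_map_of_injective (f := H.subtype) H.subtype_injective]
    congr
    ext x
    simp [AddSubgroup.mem_map, AddMonoidHom.mem_ker, and_comm]

theorem AddSubgroup.log_card_map_mk' {N H : AddSubgroup A} [Finite H] (hNH : N ≤ H) :
    Real.log (Nat.card (H.map (QuotientAddGroup.mk' N)))
      = Real.log (Nat.card H) - Real.log (Nat.card N) := by
  have h := H.card_map_mul_card_inf_ker (QuotientAddGroup.mk' N)
  rw [QuotientAddGroup.ker_mk', inf_eq_right.2 hNH] at h
  obtain ⟨h₁, h₂⟩ := mul_ne_zero_iff.1 (h ▸ Nat.card_pos.ne')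
  rw [← h, Nat.cast_mul, Real.log_mul (by exact_mod_cast h₁) (by exact_mod_cast h₂)]
  ring

theorem AddSubgroup.bijective_out_add (N : AddSubgroup A) :
    Function.Bijective fun p : (A ⧸ N) × N => p.1.out + (p.2 : A) := by
  constructor
  · rintro ⟨q, n⟩ ⟨q', n'⟩ h
    have hq : q = q' := by
      have := congrArg (QuotientAddGroup.mk (s := N)) h
      simpa [(QuotientAddGroup.eq_zero_iff _).2 n.2, (QuotientAddGroup.eq_zero_iff _).2 n'.2]
        using this
    subst hq
    simpa using h
  · intro a
    refine ⟨((a : A ⧸ N), ⟨-(a : A ⧸ N).out + a, ?_⟩), by simp⟩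
    rw [← QuotientAddGroup.eq]
    simp

theorem AddSubgroup.tsum_quotient_tsum (N : AddSubgroup A) (g : A → ℝ≥0∞) :
    ∑' z : A ⧸ N, ∑' h : N, g (z.out + h) = ∑' a, g a := by
  rw [← ENNReal.tsum_prod (f := fun (z : A ⧸ N) (h : N) => g (z.out + h))]
  exact (Equiv.ofBijective _ N.bijective_out_add).tsum_eq g

theorem AddSubgroup.tsum_add_eq_of_mk_eq (N : AddSubgroup A) (g : A → ℝ≥0∞) {a b : A}
    (h : (a : A ⧸ N) = b) : ∑' n : N, g (a + n) = ∑' n : N, g (b + n) := by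
  rw [← (Equiv.addLeft (⟨-a + b, QuotientAddGroup.eq.1 h⟩ : N)).tsum_eq]
  exact tsum_congr fun n => by simp [← add_assoc]

theorem AddMonoidHom.tsum_comp_le [Finite A] (f : A →+ B) (F : B → ℝ≥0∞) :
    ∑' x, F (f x) ≤ Nat.card f.ker * ∑' y, F y := by
  rw [← f.ker.tsum_quotient_tsum, ← ENNReal.tsum_mul_left]
  have hk : ∀ q : A ⧸ f.ker, ∑' h : f.ker, F (f (q.out + h))
      = Nat.card f.ker * F (QuotientAddGroup.kerLift f q) := by
    intro q
    have : ∀ h : f.ker, F (f (q.out + h)) = F (QuotientAddGroup.kerLift f q) := by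
      intro h
      rw [map_add, f.mem_ker.1 h.2, add_zero]
      conv_rhs => rw [← QuotientAddGroup.out_eq' q]
      rfl
    simp_rw [this, ENNReal.tsum_const, ENat.card_eq_coe_natCard]
    rfl
  simp_rw [hk]
  exact ENNReal.tsum_comp_le_tsum_of_injective (QuotientAddGroup.kerLift_injective f)
    fun y => Nat.card f.ker * F y

end Counting

section Datum

variable {G : Type*} [AddCommGroup G] {m : ℕ} {Gj : Fin m → Type*}
  [∀ j, AddCommGroup (Gj j)] (φ : ∀ j, G →+ Gj j)

theorem HBLBound.mono {φ : ∀ j, G →+ Gj j} {s : Fin m → ℝ} {C D : ℝ≥0∞} (h : HBLBound φ s C)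
    (hCD : C ≤ D) : HBLBound φ s D :=
  fun g => (h g).trans (by gcongr)

/-- Interpolation between exponents, a consequence of Hölder's inequality. -/
theorem HBLBound.interpolate [Finite G] {φ : ∀ j, G →+ Gj j} {s₀ s₁ : Fin m → ℝ} {C₀ C₁ : ℝ≥0∞}
    (h₀ : HBLBound φ s₀ C₀) (h₁ : HBLBound φ s₁ C₁) (hs₀ : ∀ j, 0 ≤ s₀ j) (hs₁ : ∀ j, 0 ≤ s₁ j)
    {p q : ℝ} (hp : 0 < p) (hq : 0 < q) (hpq : p + q = 1) :
    HBLBound φ (fun j => p * s₀ j + q * s₁ j) (C₀ ^ p * C₁ ^ q) := by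
  intro g
  have := Fintype.ofFinite G
  have key : ∀ u : Fin m → ℝ≥0∞, ∏ j, u j ^ (p * s₀ j + q * s₁ j)
      = (∏ j, u j ^ s₀ j) ^ p * (∏ j, u j ^ s₁ j) ^ q := by
    intro u
    rw [← ENNReal.prod_rpow_of_nonneg hp.le, ← ENNReal.prod_rpow_of_nonneg hq.le,
      ← Finset.prod_mul_distrib]
    refine Finset.prod_congr rfl fun j _ => ?_
    rw [ENNReal.rpow_add_of_nonneg _ _ (mul_nonneg hp.le (hs₀ j)) (mul_nonneg hq.le (hs₁ j)),
      mul_comm p, mul_comm q, ENNReal.rpow_mul, ENNReal.rpow_mul]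
  have hconj : p⁻¹.HolderConjugate q⁻¹ := Real.HolderConjugate.inv_inv hp hq hpq
  simp only [key]
  calc ∑' x, (∏ j, g j (φ j x) ^ s₀ j) ^ p * (∏ j, g j (φ j x) ^ s₁ j) ^ q
      ≤ (∑' x, ∏ j, g j (φ j x) ^ s₀ j) ^ p * (∑' x, ∏ j, g j (φ j x) ^ s₁ j) ^ q := by
        simp only [tsum_fintype]
        refine (ENNReal.inner_le_Lp_mul_Lq Finset.univ _ _ hconj).trans_eq ?_
        simp [← ENNReal.rpow_mul, mul_inv_cancel₀ hp.ne', mul_inv_cancel₀ hq.ne']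
    _ ≤ (C₀ * ∏ j, (∑' y, g j y) ^ s₀ j) ^ p * (C₁ * ∏ j, (∑' y, g j y) ^ s₁ j) ^ q := by
        gcongr
        · exact h₀ g
        · exact h₁ g
    _ = _ := by
        rw [ENNReal.mul_rpow_of_nonneg _ _ hp.le, ENNReal.mul_rpow_of_nonneg _ _ hq.le]
        ring

/-- Admissible constants multiply along a subgroup and the corresponding quotient. -/
theorem HBLBound.mul_quotient {s : Fin m → ℝ} {C D : ℝ≥0∞} (N : AddSubgroup G)
    (hN : HBLBound (fun j => (φ j).addSubgroupMap N) s C)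
    (hQ : HBLBound (fun j => QuotientAddGroup.map N (N.map (φ j)) (φ j)
      (N.le_comap_map (φ j))) s D) :
    HBLBound φ s (C * D) := by
  intro g
  let k : ∀ j, Gj j ⧸ N.map (φ j) → ℝ≥0∞ := fun j z => ∑' h : N.map (φ j), g j (z.out + h)
  have hk : ∀ q : G ⧸ N, ∑' h : N, ∏ j, g j (φ j (q.out + h)) ^ s j
      ≤ C * ∏ j, k j (QuotientAddGroup.map N (N.map (φ j)) (φ j) (N.le_comap_map (φ j)) q) ^ s j
      := by
    intro q
    have := hN fun j y => g j (φ j q.out + y)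
    simp only [map_add]
    refine this.trans_eq ?_
    congr 1
    refine Finset.prod_congr rfl fun j _ => ?_
    congr 1
    apply AddSubgroup.tsum_add_eq_of_mk_eq
    conv_rhs => rw [QuotientAddGroup.out_eq', ← QuotientAddGroup.out_eq' q]
    rfl
  calc ∑' x, ∏ j, g j (φ j x) ^ s j
      = ∑' q : G ⧸ N, ∑' h : N, ∏ j, g j (φ j (q.out + h)) ^ s j :=
        (N.tsum_quotient_tsum _).symm
    _ ≤ _ := ENNReal.tsum_le_tsum hk
    _ ≤ C * (D * ∏ j, (∑' z, k j z) ^ s j) := by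
        rw [ENNReal.tsum_mul_left]
        gcongr
        exact hQ k
    _ = _ := by
        simp only [k, AddSubgroup.tsum_quotient_tsum, mul_assoc]

/-- The joint kernel of the maps with exponent one. -/
def HBLker (s : Fin m → ℝ) : AddSubgroup G := ⨅ j, ⨅ _ : s j = 1, (φ j).ker

theorem mem_HBLker {s : Fin m → ℝ} {x : G} : x ∈ HBLker φ s ↔ ∀ j, s j = 1 → φ j x = 0 := by
  simp [HBLker, AddSubgroup.mem_iInf, AddMonoidHom.mem_ker]

theorem HBLBound.of_zero_or_one [Finite G] [∀ j, Finite (Gj j)] {s : Fin m → ℝ}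
    (hs : ∀ j, s j = 0 ∨ s j = 1) : HBLBound φ s (Nat.card (HBLker φ s)) := by
  classical
  intro g
  have := fun j => Fintype.ofFinite (Gj j)
  let Φ : G →+ (∀ j, Gj j) := AddMonoidHom.pi fun j => if s j = 1 then φ j else 0
  let g' : ∀ j, Gj j → ℝ≥0∞ := fun j => if s j = 1 then g j else Pi.single 0 1
  have hΦ : ∀ x j, Φ x j = (if s j = 1 then φ j else 0) x := fun _ _ => rfl
  have hker : Φ.ker = HBLker φ s := by
    ext x
    rw [mem_HBLker, AddMonoidHom.mem_ker, funext_iff]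
    refine forall_congr' fun j => ?_
    by_cases h : s j = 1 <;> simp [hΦ, h]
  have h1 : ∀ x j, g j (φ j x) ^ s j = g' j (Φ x j) := by
    intro x j
    rcases hs j with h | h <;> simp [g', hΦ, h]
  have h2 : ∀ j, (∑' y, g j y) ^ s j = ∑' y, g' j y := by
    intro j
    rcases hs j with h | h <;> simp [g', h]
  simp only [h1, h2]
  refine (Φ.tsum_comp_le fun y => ∏ j, g' j (y j)).trans_eq ?_
  simp only [tsum_fintype, Finset.prod_univ_sum, hker, Fintype.piFinset_univ]

theorem ENNReal.natCast_rpow_eq_ofReal_exp {n : ℕ} (hn : 0 < n) (r : ℝ) :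
    (n : ℝ≥0∞) ^ r = ENNReal.ofReal (Real.exp (r * Real.log n)) := by
  have hn' : (0 : ℝ) < n := by exact_mod_cast hn
  rw [← ENNReal.ofReal_natCast, ENNReal.ofReal_rpow_of_pos hn', Real.rpow_def_of_pos hn',
    mul_comm]

theorem ENNReal.natCast_eq_ofReal_exp_log {n : ℕ} (hn : 0 < n) :
    (n : ℝ≥0∞) = ENNReal.ofReal (Real.exp (Real.log n)) := by
  simpa using ENNReal.natCast_rpow_eq_ofReal_exp hn 1

theorem HBLAloc_eq_ofReal_exp [Finite G] (s : Fin m → ℝ) (H : AddSubgroup G) :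
    HBLAloc φ s H = ENNReal.ofReal (Real.exp (HBLlog φ s H)) := by
  have : ∀ j, Finite (H.map (φ j)) := fun j => Set.toFinite (φ j '' H)
  rw [HBLAloc, ENNReal.natCast_eq_ofReal_exp_log Nat.card_pos]
  simp only [fun j => ENNReal.natCast_rpow_eq_ofReal_exp (Nat.card_pos (α := H.map (φ j))) (-s j)]
  rw [← ENNReal.ofReal_prod_of_nonneg fun _ _ => (Real.exp_pos _).le, ← Real.exp_sum,
    ← ENNReal.ofReal_mul (Real.exp_pos _).le, ← Real.exp_add, HBLlog]
  simp [sub_eq_add_neg]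

theorem HBLker_map_eq_bot {s : Fin m → ℝ} {j : Fin m} (hj : s j = 1) :
    (HBLker φ s).map (φ j) = ⊥ := by
  rw [AddSubgroup.map_eq_bot_iff]
  exact fun x hx => (mem_HBLker φ).1 hx j hj

theorem HBLBound.of_subsingleton_fractional [Finite G] [∀ j, Finite (Gj j)] {s : Fin m → ℝ}
    {a : ℝ} (ha : ∀ H, HBLlog φ s H ≤ a) (k : Fin m) (hk : s k ∈ Set.Icc (0 : ℝ) 1)
    (hs : ∀ j, j ≠ k → s j = 0 ∨ s j = 1) :
    HBLBound φ s (ENNReal.ofReal (Real.exp a)) := by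
  by_cases hk' : s k = 0 ∨ s k = 1
  · have hs' : ∀ j, s j = 0 ∨ s j = 1 := fun j => by
      by_cases h : j = k
      · exact h ▸ hk'
      · exact hs j h
    refine (HBLBound.of_zero_or_one φ hs').mono ?_
    rw [ENNReal.natCast_eq_ofReal_exp_log Nat.card_pos]
    gcongr
    refine le_of_eq_of_le ?_ (ha (HBLker φ s))
    rw [HBLlog, Finset.sum_eq_zero, sub_zero]
    intro j _
    rcases hs' j with h | h
    · simp [h]
    · simp [HBLker_map_eq_bot φ h]
  · push Not at hk'
    have hk0 : 0 < s k := lt_of_le_of_ne hk.1 hk'.1.symm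
    have hk1 : 0 < 1 - s k := sub_pos.2 (lt_of_le_of_ne hk.2 hk'.2)
    set s₀ := Function.update s k 0 with hs₀
    set s₁ := Function.update s k 1 with hs₁
    have h₀ : ∀ j, s₀ j = 0 ∨ s₀ j = 1 := fun j => by
      by_cases h : j = k
      · simp [hs₀, h]
      · simpa [hs₀, h] using hs j h
    have h₁ : ∀ j, s₁ j = 0 ∨ s₁ j = 1 := fun j => by
      by_cases h : j = k
      · simp [hs₁, h]
      · simpa [hs₁, h] using hs j h
    have key := (HBLBound.of_zero_or_one φ h₀).interpolate (HBLBound.of_zero_or_one φ h₁)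
      (fun j => by rcases h₀ j with h | h <;> simp [h])
      (fun j => by rcases h₁ j with h | h <;> simp [h]) hk1 hk0 (by ring)
    have hs_eq : (fun j => (1 - s k) * s₀ j + s k * s₁ j) = s := by
      ext j
      by_cases h : j = k
      · subst h; simp [hs₀, hs₁]
      · simp only [hs₀, hs₁, Function.update_of_ne h]; ring
    rw [hs_eq] at key
    refine key.mono ?_
    have hker : HBLker φ s₁ = HBLker φ s₀ ⊓ (φ k).ker := by
      ext x
      simp only [AddSubgroup.mem_inf, mem_HBLker, AddMonoidHom.mem_ker]
      constructor
      · refine fun h => ⟨fun j hj => h j ?_, h k (by simp [hs₁])⟩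
        by_cases hjk : j = k
        · simp [hs₁, hjk]
        · simpa [hs₀, hs₁, hjk] using hj
      · rintro ⟨h, h'⟩ j hj
        by_cases hjk : j = k
        · exact hjk ▸ h'
        · exact h j (by simpa [hs₀, hs₁, hjk] using hj)
    have hcard := (HBLker φ s₀).card_map_mul_card_inf_ker (φ k)
    rw [← hker] at hcard
    have hlog : Real.log (Nat.card (HBLker φ s₀))
        = Real.log (Nat.card ((HBLker φ s₀).map (φ k))) + Real.log (Nat.card (HBLker φ s₁)) := by
      rw [← Real.log_mul (by exact_mod_cast Nat.card_pos.ne')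
        (by exact_mod_cast Nat.card_pos.ne')]
      exact_mod_cast congrArg (fun n : ℕ => Real.log n) hcard.symm
    rw [ENNReal.natCast_rpow_eq_ofReal_exp Nat.card_pos,
      ENNReal.natCast_rpow_eq_ofReal_exp Nat.card_pos,
      ← ENNReal.ofReal_mul (Real.exp_pos _).le, ← Real.exp_add]
    gcongr
    refine le_of_eq_of_le ?_ (ha (HBLker φ s₀))
    rw [HBLlog, Finset.sum_eq_single k, hlog]
    · ring
    · intro j _ hj
      rcases hs j hj with h | h
      · simp [h]
      · rw [HBLker_map_eq_bot φ (by simpa [hs₀, hj] using h)]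
        simp
    · simp

/-- Moving along a ray from a point where finitely many affine constraints hold, until one that
increases along the ray becomes tight. -/
theorem exists_tight_constraint {ι : Type*} [Finite ι] (c d : ι → ℝ) (hc : ∀ i, c i ≤ 0)
    (hd : ∃ i, 0 < d i) :
    ∃ t, 0 ≤ t ∧ (∀ i, c i + t * d i ≤ 0) ∧ ∃ i, 0 < d i ∧ c i + t * d i = 0 := by
  obtain ⟨i, hi, hmin⟩ := Set.exists_min_image {i | 0 < d i} (fun i => -c i / d i)
    (Set.toFinite _) hd
  have ht : 0 ≤ -c i / d i := div_nonneg (neg_nonneg.2 (hc i)) (le_of_lt hi)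
  refine ⟨-c i / d i, ht, fun k => ?_, i, hi, ?_⟩
  · rcases le_or_gt (d k) 0 with hk | hk
    · nlinarith [hc k]
    · have := (le_div_iff₀ hk).1 (hmin k hk)
      linarith
  · rw [div_mul_cancel₀ _ (ne_of_gt hi)]
    ring

theorem HBLlog_add_smul (s v : Fin m → ℝ) (t : ℝ) (H : AddSubgroup G) :
    HBLlog φ (fun j => s j + t * v j) H
      = HBLlog φ s H + t * -∑ j, v j * Real.log (Nat.card (H.map (φ j))) := by
  simp only [HBLlog, add_mul, Finset.sum_add_distrib, mul_assoc, ← Finset.mul_sum]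
  ring

/-- Along a direction preserving `A(G,s)`, an exponent vector can be moved until a coordinate
reaches `0` or `1`, or the constraint of a nontrivial proper subgroup becomes tight. -/
theorem exists_extremal_along [Finite G] {s : Fin m → ℝ} {a : ℝ} (ha : ∀ H, HBLlog φ s H ≤ a)
    (hs : ∀ j, s j ∈ Set.Icc (0 : ℝ) 1) {v : Fin m → ℝ} (hv : v ≠ 0)
    (htop : ∑ j, v j * Real.log (Nat.card ((⊤ : AddSubgroup G).map (φ j))) = 0) :
    ∃ t, 0 ≤ t ∧ (∀ H, HBLlog φ (fun j => s j + t * v j) H ≤ a) ∧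
      (∀ j, s j + t * v j ∈ Set.Icc (0 : ℝ) 1) ∧
      ((∃ H, H ≠ ⊥ ∧ H ≠ ⊤ ∧ HBLlog φ (fun j => s j + t * v j) H = a) ∨
        ∃ j, v j ≠ 0 ∧ (s j + t * v j = 0 ∨ s j + t * v j = 1)) := by
  let c : AddSubgroup G ⊕ (Fin m ⊕ Fin m) → ℝ :=
    Sum.elim (fun H => HBLlog φ s H - a) (Sum.elim (fun j => s j - 1) fun j => -s j)
  let d : AddSubgroup G ⊕ (Fin m ⊕ Fin m) → ℝ :=
    Sum.elim (fun H => -∑ j, v j * Real.log (Nat.card (H.map (φ j)))) (Sum.elim v (-v))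
  obtain ⟨t, ht, hle, i, hi, heq⟩ := exists_tight_constraint c d
    (by
      rintro (H | j | j)
      · exact sub_nonpos.2 (ha H)
      · exact sub_nonpos.2 (hs j).2
      · exact neg_nonpos.2 (hs j).1)
    (by
      obtain ⟨j, hj⟩ := Function.ne_iff.1 hv
      rcases lt_or_gt_of_ne hj with h | h
      · exact ⟨.inr (.inr j), neg_pos.2 h⟩
      · exact ⟨.inr (.inl j), h⟩)
  refine ⟨t, ht, fun H => ?_, fun j => ⟨?_, ?_⟩, ?_⟩
  · have := hle (.inl H)
    simp only [c, d, Sum.elim_inl] at this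
    rw [HBLlog_add_smul]
    linarith
  · have := hle (.inr (.inr j))
    simp only [c, d, Sum.elim_inr, Pi.neg_apply] at this
    linarith
  · have := hle (.inr (.inl j))
    simp only [c, d, Sum.elim_inr, Sum.elim_inl] at this
    linarith
  · rcases i with H | j | j <;>
      simp only [c, d, Sum.elim_inr, Sum.elim_inl, Pi.neg_apply] at hi heq
    · refine .inl ⟨H, ?_, ?_, ?_⟩
      · rintro rfl
        simp at hi
      · rintro rfl
        rw [htop] at hi
        simp at hi
      · rw [HBLlog_add_smul]
        linarith
    · exact .inr ⟨j, hi.ne', .inr (by linarith)⟩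
    · exact .inr ⟨j, (neg_pos.1 hi).ne, .inl (by linarith)⟩

theorem HBLBound.of_between [Finite G] {φ : ∀ j, G →+ Gj j} {s v : Fin m → ℝ} {C : ℝ≥0∞}
    {t₁ t₂ : ℝ} (ht₁ : 0 ≤ t₁) (ht₂ : 0 ≤ t₂)
    (h₁ : HBLBound φ (fun j => s j + t₁ * v j) C) (h₂ : HBLBound φ (fun j => s j + t₂ * -v j) C)
    (hs₁ : ∀ j, 0 ≤ s j + t₁ * v j) (hs₂ : ∀ j, 0 ≤ s j + t₂ * -v j) :
    HBLBound φ s C := by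
  rcases ht₁.eq_or_lt with rfl | ht₁
  · simpa using h₁
  rcases ht₂.eq_or_lt with rfl | ht₂
  · simpa using h₂
  have hsum : t₂ / (t₁ + t₂) + t₁ / (t₁ + t₂) = 1 := by field_simp; ring
  have key := h₁.interpolate h₂ hs₁ hs₂ (p := t₂ / (t₁ + t₂)) (q := t₁ / (t₁ + t₂))
    (by positivity) (by positivity) hsum
  rw [← ENNReal.rpow_add_of_nonneg _ _ (by positivity) (by positivity), hsum,
    ENNReal.rpow_one] at key
  convert key using 2 with j
  field_simp
  ring

/-- The exponents attaining a common bound are controlled by those for which a nontrivial proper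
subgroup is critical. -/
theorem HBLBound.of_forall_critical [Finite G] [∀ j, Finite (Gj j)] (hm : 0 < m) {a : ℝ}
    (hcrit : ∀ s : Fin m → ℝ, (∀ j, s j ∈ Set.Icc (0 : ℝ) 1) → (∀ H, HBLlog φ s H ≤ a) →
      (∃ H, H ≠ ⊥ ∧ H ≠ ⊤ ∧ HBLlog φ s H = a) →
      HBLBound φ s (ENNReal.ofReal (Real.exp a)))
    (s : Fin m → ℝ) (hs : ∀ j, s j ∈ Set.Icc (0 : ℝ) 1) (ha : ∀ H, HBLlog φ s H ≤ a) :
    HBLBound φ s (ENNReal.ofReal (Real.exp a)) := by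
  classical
  let frac : (Fin m → ℝ) → Finset (Fin m) := fun s => {j | s j ≠ 0 ∧ s j ≠ 1}
  induction hn : (frac s).card using Nat.strong_induction_on generalizing s with
  | _ n ih =>
  subst hn
  by_cases hfrac : ∃ j ∈ frac s, ∃ k ∈ frac s, j ≠ k
  · obtain ⟨j, hj, k, hk, hjk⟩ := hfrac
    obtain ⟨v, hv, hsupp, htop⟩ : ∃ v : Fin m → ℝ, v ≠ 0 ∧ (∀ i, v i ≠ 0 → i ∈ frac s) ∧
        ∑ i, v i * Real.log (Nat.card ((⊤ : AddSubgroup G).map (φ i))) = 0 := by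
      set l : Fin m → ℝ := fun i => Real.log (Nat.card ((⊤ : AddSubgroup G).map (φ i)))
      by_cases hl : l j = 0
      · refine ⟨Pi.single j 1, by simp, fun i hi => ?_, ?_⟩
        · by_cases hij : i = j
          · exact hij ▸ hj
          · simp [hij] at hi
        · change ∑ i, Pi.single (M := fun _ => ℝ) j 1 i * l i = 0
          rw [Finset.sum_eq_single j] <;> simp +contextual [hl]
      · refine ⟨Pi.single j (-l k) + Pi.single k (l j), fun h => hl ?_, fun i hi => ?_, ?_⟩
        · simpa [hjk, hjk.symm] using congrFun h k
        · by_cases hij : i = j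
          · exact hij ▸ hj
          · by_cases hik : i = k
            · exact hik ▸ hk
            · simp [hij, hik] at hi
        · change ∑ i, (Pi.single j (-l k) + Pi.single k (l j) : Fin m → ℝ) i * l i = 0
          simp only [Pi.add_apply, add_mul, Finset.sum_add_distrib, Pi.single_apply, ite_mul,
            zero_mul, Finset.sum_ite_eq', Finset.mem_univ, if_true]
          ring
    have step : ∀ w : Fin m → ℝ, (∀ i, w i ≠ 0 → i ∈ frac s) → ∀ t : ℝ,
        (∀ H, HBLlog φ (fun i => s i + t * w i) H ≤ a) →
        (∀ i, s i + t * w i ∈ Set.Icc (0 : ℝ) 1) →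
        ((∃ H, H ≠ ⊥ ∧ H ≠ ⊤ ∧ HBLlog φ (fun i => s i + t * w i) H = a) ∨
          ∃ i, w i ≠ 0 ∧ (s i + t * w i = 0 ∨ s i + t * w i = 1)) →
        HBLBound φ (fun i => s i + t * w i) (ENNReal.ofReal (Real.exp a)) := by
      intro w hw t hlog hIcc h
      rcases h with h | ⟨i, hwi, hi⟩
      · exact hcrit _ hIcc hlog h
      · refine ih _ (Finset.card_lt_card ?_) _ hIcc hlog rfl
        refine (Finset.ssubset_iff_of_subset fun i' hi' => ?_).2 ⟨i, hw i hwi, ?_⟩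
        · by_cases hwi' : w i' = 0
          · simpa [frac, hwi'] using hi'
          · exact hw i' hwi'
        · simp only [frac, Finset.mem_filter, Finset.mem_univ, true_and]
          tauto
    obtain ⟨t₁, ht₁, hlog₁, hIcc₁, h₁⟩ := exists_extremal_along φ ha hs hv htop
    obtain ⟨t₂, ht₂, hlog₂, hIcc₂, h₂⟩ := exists_extremal_along φ ha hs (neg_ne_zero.2 hv)
      (by simpa using htop)
    exact HBLBound.of_between ht₁ ht₂ (step v hsupp t₁ hlog₁ hIcc₁ h₁)
      (step (-v) (fun i hi => hsupp i (by simpa using hi)) t₂ hlog₂ hIcc₂ h₂)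
      (fun i => (hIcc₁ i).1) fun i => (hIcc₂ i).1
  · push Not at hfrac
    obtain ⟨k, hk⟩ : ∃ k, ∀ j ∈ frac s, j = k := by
      rcases (frac s).eq_empty_or_nonempty with h | ⟨k, hk⟩
      · exact ⟨⟨0, hm⟩, by simp [h]⟩
      · exact ⟨k, fun j hj => hfrac j hj k hk⟩
    refine HBLBound.of_subsingleton_fractional φ ha k (hs k) fun j hj => ?_
    by_contra h
    push Not at h
    exact hj (hk j (by simpa [frac] using h))

theorem HBLlog_addSubgroupMap (s : Fin m → ℝ) (N : AddSubgroup G) (H : AddSubgroup N) :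
    HBLlog (fun j => (φ j).addSubgroupMap N) s H = HBLlog φ s (H.map N.subtype) := by
  have h : ∀ j, Nat.card (H.map ((φ j).addSubgroupMap N))
      = Nat.card ((H.map N.subtype).map (φ j)) := by
    intro j
    rw [← AddSubgroup.card_map_of_injective (f := (N.map (φ j)).subtype)
      (AddSubgroup.subtype_injective _), AddSubgroup.map_map, AddSubgroup.map_map]
    rfl
  simp only [HBLlog, h, AddSubgroup.card_map_of_injective N.subtype_injective]

theorem HBLlog_quotient_map [Finite G] (s : Fin m → ℝ) (N : AddSubgroup G)
    (H : AddSubgroup (G ⧸ N)) :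
    HBLlog (fun j => QuotientAddGroup.map N (N.map (φ j)) (φ j) (N.le_comap_map (φ j))) s H
      = HBLlog φ s (H.comap (QuotientAddGroup.mk' N)) - HBLlog φ s N := by
  set M := H.comap (QuotientAddGroup.mk' N) with hM
  have hNM : N ≤ M := fun x hx => by
    simp [hM, (QuotientAddGroup.eq_zero_iff x).2 hx]
  have hMH : M.map (QuotientAddGroup.mk' N) = H :=
    AddSubgroup.map_comap_eq_self_of_surjective (QuotientAddGroup.mk'_surjective N) H
  have h : ∀ j, (H.map (QuotientAddGroup.map N (N.map (φ j)) (φ j) (N.le_comap_map (φ j))))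
      = (M.map (φ j)).map (QuotientAddGroup.mk' (N.map (φ j))) := fun j => by
    rw [← hMH, AddSubgroup.map_map, AddSubgroup.map_map]
    rfl
  have hH : Real.log (Nat.card H) = Real.log (Nat.card M) - Real.log (Nat.card N) := by
    rw [← AddSubgroup.log_card_map_mk' hNM, hMH]
  have : ∀ j, Finite (M.map (φ j)) := fun j => Set.toFinite (φ j '' M)
  simp only [HBLlog, h, hH,
    fun j => AddSubgroup.log_card_map_mk' (AddSubgroup.map_mono (f := φ j) hNM), mul_sub,
    Finset.sum_sub_distrib]
  ring

end Datum

/-- The optimal constant is at most `𝔸(𝒢,s)`, in logarithmic form. -/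
theorem HBLBound.of_HBLlog_le {m : ℕ} (hm : 0 < m) {G : Type*} [AddCommGroup G] [Finite G]
    {Gj : Fin m → Type*} [∀ j, AddCommGroup (Gj j)] [∀ j, Finite (Gj j)] (φ : ∀ j, G →+ Gj j)
    {a : ℝ} (s : Fin m → ℝ) (hs : ∀ j, s j ∈ Set.Icc (0 : ℝ) 1) (ha : ∀ H, HBLlog φ s H ≤ a) :
    HBLBound φ s (ENNReal.ofReal (Real.exp a)) := by
  induction hn : Nat.card G using Nat.strong_induction_on generalizing G Gj a s with
  | _ n ih =>
  subst hn
  refine HBLBound.of_forall_critical φ hm (fun s hs ha ⟨N, hbot, htop, hN⟩ => ?_) s hs ha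
  have hcard := N.card_eq_card_quotient_mul_card_addSubgroup
  have hN1 : 1 < Nat.card N := (AddSubgroup.one_lt_card_iff_ne_bot N).2 hbot
  have hNG : Nat.card N < Nat.card G :=
    lt_of_le_of_ne N.card_le_card_addGroup fun h => htop (N.eq_top_of_card_eq h)
  have hQG : Nat.card (G ⧸ N) < Nat.card G := by
    rw [hcard]
    exact lt_mul_of_one_lt_right Nat.card_pos hN1
  have hsub := ih _ hNG (fun j => (φ j).addSubgroupMap N) s hs (a := a)
    (fun H => (HBLlog_addSubgroupMap φ s N H).trans_le (ha _)) rfl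
  have hquot := ih _ hQG (fun j => QuotientAddGroup.map N (N.map (φ j)) (φ j)
    (N.le_comap_map (φ j))) s hs (a := 0)
    (fun H => by
      rw [HBLlog_quotient_map, hN]
      exact sub_nonpos.2 (ha _)) rfl
  simpa using HBLBound.mul_quotient φ N hsub hquot

section Optimal

variable {G : Type*} [AddCommGroup G] {m : ℕ} {Gj : Fin m → Type*}
  [∀ j, AddCommGroup (Gj j)] {φ : ∀ j, G →+ Gj j} {s : Fin m → ℝ}

theorem HBLBound.HBLB_le {C : ℝ≥0∞} (h : HBLBound φ s C) : HBLB φ s ≤ C := by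
  refine sInf_le fun f => ?_
  let c : Fin m → ℝ≥0∞ := fun j => if s j = 0 then ⨆ y, f j y else 1
  have hf : ∀ j y, f j y ≤ c j * (f j y ^ (1 / s j)) ^ s j := by
    intro j y
    by_cases hj : s j = 0
    · simpa [c, hj] using le_iSup (f j) y
    · simp [c, hj, ← ENNReal.rpow_mul]
  have hnorm : ∀ j, HBLnorm (s j) (f j) = c j * (∑' y, f j y ^ (1 / s j)) ^ s j := by
    intro j
    by_cases hj : s j = 0 <;> simp [HBLnorm, c, hj]
  calc ∑' x, ∏ j, f j (φ j x)
      ≤ ∑' x, (∏ j, c j) * ∏ j, (f j (φ j x) ^ (1 / s j)) ^ s j := by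
        refine ENNReal.tsum_le_tsum fun x => ?_
        rw [← Finset.prod_mul_distrib]
        exact Finset.prod_le_prod' fun j _ => hf j _
    _ ≤ (∏ j, c j) * (C * ∏ j, (∑' y, f j y ^ (1 / s j)) ^ s j) := by
        rw [ENNReal.tsum_mul_left]
        gcongr
        exact h fun j y => f j y ^ (1 / s j)
    _ = C * ∏ j, HBLnorm (s j) (f j) := by
        simp only [hnorm, Finset.prod_mul_distrib]
        ring

theorem HBLnorm_indicator_one {α : Type*} {r : ℝ} (hr : 0 ≤ r) (S : Set α) [Finite S]
    (hS : S.Nonempty) : HBLnorm r (S.indicator (1 : α → ℝ≥0∞)) = (Nat.card S : ℝ≥0∞) ^ r := by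
  classical
  by_cases h : r = 0
  · obtain ⟨y, hy⟩ := hS
    simp only [HBLnorm, h, if_true, ENNReal.rpow_zero]
    refine le_antisymm (iSup_le fun z => Set.indicator_le_self' (fun _ _ => zero_le_one) z) ?_
    exact le_iSup_of_le y (by simp [hy])
  · have hr' : 0 < 1 / r := one_div_pos.2 (lt_of_le_of_ne hr (Ne.symm h))
    have : ∀ y, S.indicator (1 : α → ℝ≥0∞) y ^ (1 / r) = S.indicator 1 y := fun y => by
      by_cases hy : y ∈ S
      · simp [hy]
      · simp only [Set.indicator_of_notMem hy]
        exact ENNReal.zero_rpow_of_pos hr'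
    simp only [HBLnorm, h, if_false, this]
    rw [← tsum_subtype]
    simp only [Pi.one_apply, ENNReal.tsum_const, ENat.card_eq_coe_natCard, mul_one]
    rfl

theorem HBLA_le_HBLB (hs : ∀ j, 0 ≤ s j) : HBLA φ s ≤ HBLB φ s := by
  refine iSup₂_le fun H hH => le_sInf fun C hC => ?_
  have : Finite H := hH
  have hmap : ∀ j, Finite (H.map (φ j)) := fun j => hH.image (φ j)
  have key := hC fun j => (H.map (φ j) : Set (Gj j)).indicator 1
  simp only [fun j => HBLnorm_indicator_one (hs j) (H.map (φ j) : Set (Gj j))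
    ⟨0, (H.map (φ j)).zero_mem⟩] at key
  have hcard : (Nat.card H : ℝ≥0∞)
      ≤ ∑' x, ∏ j, (H.map (φ j) : Set (Gj j)).indicator (1 : Gj j → ℝ≥0∞) (φ j x) := by
    calc (Nat.card H : ℝ≥0∞) = ∑' _ : H, 1 := by simp [ENat.card_eq_coe_natCard]
      _ ≤ ∑' x : H, ∏ j, (H.map (φ j) : Set (Gj j)).indicator (1 : Gj j → ℝ≥0∞) (φ j x) := by
        refine ENNReal.tsum_le_tsum fun x => le_of_eq (Eq.symm ?_)
        refine Finset.prod_eq_one fun j _ => Set.indicator_of_mem ?_ _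
        exact AddSubgroup.mem_map_of_mem (φ j) x.2
      _ ≤ _ := ENNReal.tsum_comp_le_tsum_of_injective H.subtype_injective fun x =>
        ∏ j, (H.map (φ j) : Set (Gj j)).indicator (1 : Gj j → ℝ≥0∞) (φ j x)
  have hcancel : ∀ j, (Nat.card (H.map (φ j)) : ℝ≥0∞) ^ s j
      * (Nat.card (H.map (φ j)) : ℝ≥0∞) ^ (-s j) = 1 := by
    intro j
    rw [← ENNReal.rpow_add _ _ (by exact_mod_cast Nat.card_pos.ne') (ENNReal.natCast_ne_top _)]
    simp
  calc HBLAloc φ s H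
      ≤ C * (∏ j, (Nat.card (H.map (φ j)) : ℝ≥0∞) ^ s j)
          * ∏ j, (Nat.card (H.map (φ j)) : ℝ≥0∞) ^ (-s j) :=
        mul_le_mul_left (hcard.trans key) _
    _ = C := by
        rw [mul_assoc, ← Finset.prod_mul_distrib, Finset.prod_eq_one fun j _ => hcancel j, mul_one]

theorem HBLB_eq_HBLA (hm : 0 < m) [Finite G] [∀ j, Finite (Gj j)]
    (hs : ∀ j, s j ∈ Set.Icc (0 : ℝ) 1) : HBLB φ s = HBLA φ s := by
  refine le_antisymm ?_ (HBLA_le_HBLB fun j => (hs j).1)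
  obtain ⟨H, hH⟩ := Finite.exists_max (HBLlog φ s)
  refine (HBLBound.of_HBLlog_le hm φ s hs hH).HBLB_le.trans ?_
  rw [← HBLAloc_eq_ofReal_exp]
  exact le_iSup₂_of_le H (Set.toFinite _) le_rfl

end Optimal

/-- **Lemma (splitting).** For a finite Abelian group HBL datum `𝒢`, `s ∈ [0,1]^m` and a
nonzero proper subgroup `{0} < G' < G` with associated sub-datum `𝒢'`: if
`A(G',s) = 𝔸(𝒢',s)` then `𝔹(𝒢,s) = 𝔸(𝒢,s)`. -/
theorem HBL_splitting {G : Type*} [AddCommGroup G] [Fintype G]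
    {m : ℕ} (hm : 0 < m) {Gj : Fin m → Type*} [∀ j, AddCommGroup (Gj j)]
    [∀ j, Fintype (Gj j)] (φ : ∀ j, G →+ Gj j)
    (s : Fin m → ℝ) (hs : ∀ j, s j ∈ Set.Icc (0 : ℝ) 1)
    (G' : AddSubgroup G) (hG'bot : ⊥ < G') (hG'top : G' < ⊤)
    (hcrit : HBLAloc φ s G' = HBLA (fun j => (φ j).addSubgroupMap G') s) :
    HBLB φ s = HBLA φ s := by
  exact HBLB_eq_HBLA hm hs
end

section
/- Let 𝒢 = (φ_j : G → G_j : 1 ≤ j ≤ m) be an Abelian group HBL datum and let s ∈ [0,1]^m. If the intersection of the kernels Ker(φ_k), taken over all indices k with s_k = 1, equals {0}, then 𝔸(𝒢,s) = 1; that is, A(H,s) ≤ 1 for every finite subgroup H ≤ G, with equality for H = {0}. -/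
open scoped ENNReal

/-- A finite subgroup on which the homomorphisms `φ i` jointly separate points has cardinality at
most the product of the cardinalities of its images. -/
theorem AddSubgroup.card_le_prod_card_map {G ι : Type*} [AddCommGroup G] [Fintype ι]
    {Gj : ι → Type*} [∀ i, AddCommGroup (Gj i)] (φ : ∀ i, G →+ Gj i)
    (hK : (⨅ i, (φ i).ker) = ⊥) (H : AddSubgroup G) [Finite H] :
    Nat.card H ≤ ∏ i, Nat.card (H.map (φ i)) := by
  have (i : ι) : Finite (H.map (φ i)) :=
    ((Set.toFinite (H : Set G)).image (φ i)).to_subtype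
  rw [← Nat.card_pi]
  refine Nat.card_le_card_of_injective
    (fun (x : H) i => (⟨φ i x, AddSubgroup.mem_map_of_mem _ x.2⟩ : H.map (φ i))) fun x y h => ?_
  have hxy : (x - y : G) ∈ ⨅ i, (φ i).ker := by
    refine AddSubgroup.mem_iInf.2 fun i => ?_
    rw [AddMonoidHom.mem_ker, map_sub, sub_eq_zero]
    exact congrArg Subtype.val (congrFun h i)
  rw [hK, AddSubgroup.mem_bot, sub_eq_zero] at hxy
  exact Subtype.ext hxy

theorem HBLAloc_le_one {G : Type*} [AddCommGroup G] {m : ℕ} {Gj : Fin m → Type*}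
    [∀ j, AddCommGroup (Gj j)] (φ : ∀ j, G →+ Gj j) (s : Fin m → ℝ) (hs : ∀ j, 0 ≤ s j)
    (hK : (⨅ (k : Fin m) (_ : s k = 1), (φ k).ker) = ⊥) (H : AddSubgroup G) [Finite H] :
    HBLAloc φ s H ≤ 1 := by
  classical
  have (j : Fin m) : Finite (H.map (φ j)) :=
    ((Set.toFinite (H : Set G)).image (φ j)).to_subtype
  have one_le (j : Fin m) : (1 : ℝ≥0∞) ≤ (Nat.card (H.map (φ j)) : ℝ≥0∞) ^ s j :=
    (ENNReal.one_rpow _).ge.trans <| ENNReal.rpow_le_rpow (by exact_mod_cast Nat.card_pos) (hs j)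
  have hcard : (Nat.card H : ℝ≥0∞) ≤ ∏ j, (Nat.card (H.map (φ j)) : ℝ≥0∞) ^ s j :=
    calc (Nat.card H : ℝ≥0∞)
        ≤ ∏ k : {k // s k = 1}, (Nat.card (H.map (φ k)) : ℝ≥0∞) := by
          exact_mod_cast AddSubgroup.card_le_prod_card_map
            (fun k : {k // s k = 1} => φ k) (by rw [iInf_subtype, hK]) H
      _ = ∏ k : {k // s k = 1}, (Nat.card (H.map (φ k)) : ℝ≥0∞) ^ s k :=
          Finset.prod_congr rfl fun k _ => by rw [k.2, ENNReal.rpow_one]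
      _ = ∏ j with s j = 1, (Nat.card (H.map (φ j)) : ℝ≥0∞) ^ s j :=
          (Finset.prod_subtype _ (by simp)
            fun j => (Nat.card (H.map (φ j)) : ℝ≥0∞) ^ s j).symm
      _ ≤ ∏ j, (Nat.card (H.map (φ j)) : ℝ≥0∞) ^ s j :=
          Finset.prod_le_prod_of_subset_of_one_le' (Finset.filter_subset _ _)
            fun j _ _ => one_le j
  calc HBLAloc φ s H
      ≤ (∏ j, (Nat.card (H.map (φ j)) : ℝ≥0∞) ^ s j) *
          ∏ j, (Nat.card (H.map (φ j)) : ℝ≥0∞) ^ (-s j) := by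
        unfold HBLAloc
        gcongr
    _ ≤ 1 := by
        rw [← Finset.prod_mul_distrib]
        refine Finset.prod_le_one' fun j _ => ?_
        rw [ENNReal.rpow_neg]
        exact ENNReal.div_self_le_one

theorem HBLAloc_bot {G : Type*} [AddCommGroup G] {m : ℕ} {Gj : Fin m → Type*}
    [∀ j, AddCommGroup (Gj j)] (φ : ∀ j, G →+ Gj j) (s : Fin m → ℝ) :
    HBLAloc φ s ⊥ = 1 := by
  simp [HBLAloc]

/-- If the intersection of the kernels `Ker(φ_k)` over the indices `k` with `s_k = 1`
(the whole of `G` if there are no such indices) equals `{0}`, then `𝔸(𝒢,s) = 1`: that is,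
`A(H,s) ≤ 1` for every finite subgroup `H ≤ G`, with equality for `H = {0}`. -/
theorem HBLA_eq_one_of_inf_ker_eq_bot {G : Type*} [AddCommGroup G]
    {m : ℕ} (hm : 0 < m) {Gj : Fin m → Type*} [∀ j, AddCommGroup (Gj j)]
    (φ : ∀ j, G →+ Gj j) (s : Fin m → ℝ) (hs : ∀ j, s j ∈ Set.Icc (0 : ℝ) 1)
    (hK : (⨅ (k : Fin m) (_ : s k = 1), (φ k).ker) = ⊥) :
    HBLA φ s = 1 ∧
      (∀ H : AddSubgroup G, (H : Set G).Finite → HBLAloc φ s H ≤ 1) ∧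
      HBLAloc φ s ⊥ = 1 := by
  have hle (H : AddSubgroup G) (hH : (H : Set G).Finite) : HBLAloc φ s H ≤ 1 :=
    have : Finite H := hH.to_subtype
    HBLAloc_le_one φ s (fun j => (hs j).1) hK H
  have hbot := HBLAloc_bot φ s
  refine ⟨le_antisymm (iSup₂_le hle) ?_, hle, hbot⟩
  exact hbot.ge.trans (le_iSup₂_of_le (f := fun H _ => HBLAloc φ s H) ⊥ (by simp) le_rfl)
end
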